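/- arXiv:1810.11308 — 6 statements merged into one kernel-verified Lean document; each statement's English description precedes it below -/
import Mathlib

section
/- For all natural numbers m and d with 0 ≤ d ≤ m, the number of d-bounded permutations of Fin m equals d! · (d+1)^(m−d). That is, the cardinality of {π : Equiv.Perm (Fin m) | ∀ i, |{j | j < i ∧ π(j) > π(i)}| ≤ d} is d! · (d+1)^(m−d). -/
/-- The out-of-order distance of a permutation `π` of `Fin m` at position `i`:
the number of positions `j < i` whose value `π j` exceeds `π i`. -/
def oooDist {m : ℕ} (π : Equiv.Perm (Fin m)) (i : Fin m) : ℕ :=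
  (Finset.univ.filter (fun j : Fin m => j < i ∧ π i < π j)).card

/-- A permutation is `d`-bounded if every position is out of order by at most `d`. -/
def DBounded {m : ℕ} (d : ℕ) (π : Equiv.Perm (Fin m)) : Prop :=
  ∀ i : Fin m, oooDist π i ≤ d

/-- The permutation of `Fin (n + 1)` sending the last position to `v` and ordering the other
positions as `σ` does. -/
def appendLast {n : ℕ} (v : Fin (n + 1)) (σ : Equiv.Perm (Fin n)) : Equiv.Perm (Fin (n + 1)) :=
  (finSuccEquiv' (Fin.last n)).trans ((Equiv.optionCongr σ).trans (finSuccEquiv' v).symm)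

@[simp]
theorem appendLast_last {n : ℕ} (v : Fin (n + 1)) (σ : Equiv.Perm (Fin n)) :
    appendLast v σ (Fin.last n) = v := by
  simp [appendLast]

@[simp]
theorem appendLast_castSucc {n : ℕ} (v : Fin (n + 1)) (σ : Equiv.Perm (Fin n)) (i : Fin n) :
    appendLast v σ i.castSucc = v.succAbove (σ i) := by
  simp [appendLast, finSuccEquiv'_last_apply_castSucc]

theorem appendLast_bijective (n : ℕ) :
    Function.Bijective
      (fun p : Fin (n + 1) × Equiv.Perm (Fin n) => appendLast p.1 p.2) := by
  rw [Fintype.bijective_iff_injective_and_card]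
  refine ⟨?_, by simp [Fintype.card_perm, Nat.factorial_succ]⟩
  rintro ⟨v, σ⟩ ⟨w, τ⟩ h
  have hvw : v = w := by simpa using DFunLike.congr_fun h (Fin.last n)
  subst hvw
  refine Prod.ext rfl (Equiv.ext fun i => ?_)
  simpa using DFunLike.congr_fun h i.castSucc

theorem oooDist_last {n : ℕ} (π : Equiv.Perm (Fin (n + 1))) :
    oooDist π (Fin.last n) = n - π (Fin.last n) := by
  have h : (Finset.univ.filter fun j => j < Fin.last n ∧ π (Fin.last n) < π j).map
      π.toEmbedding = Finset.Ioi (π (Fin.last n)) := by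
    ext x
    simp only [Finset.mem_map_equiv, Finset.mem_filter, Finset.mem_univ, true_and,
      Equiv.apply_symm_apply, Finset.mem_Ioi, and_iff_right_iff_imp]
    intro hx
    refine Fin.lt_last_iff_ne_last.2 fun hl => ?_
    simp [← hl] at hx
  rw [oooDist, ← Finset.card_map π.toEmbedding, h, Fin.card_Ioi]
  omega

theorem oooDist_appendLast_castSucc {n : ℕ} (v : Fin (n + 1)) (σ : Equiv.Perm (Fin n))
    (i : Fin n) : oooDist (appendLast v σ) i.castSucc = oooDist σ i := by
  rw [oooDist, oooDist, ← Finset.card_map (Fin.castSuccEmb (n := n))]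
  congr 1
  ext j
  induction j using Fin.lastCases with
  | last => simp [(Fin.castSucc_lt_last i).le]
  | cast j => simp [Fin.succAbove_lt_succAbove_iff]

theorem dBounded_appendLast {n d : ℕ} (v : Fin (n + 1)) (σ : Equiv.Perm (Fin n)) :
    DBounded d (appendLast v σ) ↔ n - v ≤ d ∧ DBounded d σ := by
  simp only [DBounded, Fin.forall_fin_succ', oooDist_appendLast_castSucc, oooDist_last,
    appendLast_last]
  exact and_comm

theorem dBounded_of_le {m d : ℕ} (h : m ≤ d) (π : Equiv.Perm (Fin m)) : DBounded d π :=
  fun _ => (Finset.card_le_univ _).trans (by simpa using h)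

theorem ncard_dBounded_succ {n d : ℕ} (h : d ≤ n) :
    Set.ncard {π : Equiv.Perm (Fin (n + 1)) | DBounded d π} =
      (d + 1) * Set.ncard {σ : Equiv.Perm (Fin n) | DBounded d σ} := by
  have hpre : (fun p : Fin (n + 1) × Equiv.Perm (Fin n) => appendLast p.1 p.2) ⁻¹'
      {π | DBounded d π} =
        (Finset.Ici (⟨n - d, by omega⟩ : Fin (n + 1)) : Set (Fin (n + 1))) ×ˢ
          {σ | DBounded d σ} := by
    ext ⟨v, σ⟩
    simp only [Set.mem_preimage, Set.mem_ofPred_eq, dBounded_appendLast, Set.mem_prod,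
      Finset.coe_Ici, Set.mem_Ici, Fin.le_def]
    exact and_congr_left' (by omega)
  have hbij := appendLast_bijective n
  rw [← Set.ncard_preimage_of_injective_subset_range hbij.1 (by simp [hbij.2.range_eq]), hpre,
    Set.ncard_prod, Set.ncard_coe_finset, Fin.card_Ici]
  congr 1
  simp only
  omega

theorem count_d_bounded_perms (m d : ℕ) (hdm : d ≤ m) :
    Set.ncard {π : Equiv.Perm (Fin m) | DBounded d π} =
      d.factorial * (d + 1) ^ (m - d) := by
  induction m, hdm using Nat.le_induction with
  | base =>
    simp [dBounded_of_le le_rfl, Set.ncard_univ, Nat.card_eq_fintype_card, Fintype.card_perm]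
  | succ n h ih =>
    rw [ncard_dBounded_succ h, ih, Nat.succ_sub h, pow_succ]
    ring
end

section
/- For all natural numbers m and d, the number of d-bounded permutations of Fin m equals the product ∏_{k=1}^{m} min(k, d+1). -/
/-- The permutation of `Fin (n + 1)` that sends the last position to `p` and whose other values
are in the same relative order as those of `σ`. -/
def Equiv.Perm.insertLast {n : ℕ} (p : Fin (n + 1)) (σ : Equiv.Perm (Fin n)) :
    Equiv.Perm (Fin (n + 1)) :=
  ((finSuccEquiv' (Fin.last n)).trans (Equiv.optionCongr σ)).trans (finSuccEquiv' p).symm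

@[simp]
theorem Equiv.Perm.insertLast_last {n : ℕ} (p : Fin (n + 1)) (σ : Equiv.Perm (Fin n)) :
    insertLast p σ (Fin.last n) = p := by
  simp [insertLast]

@[simp]
theorem Equiv.Perm.insertLast_castSucc {n : ℕ} (p : Fin (n + 1)) (σ : Equiv.Perm (Fin n))
    (i : Fin n) : insertLast p σ i.castSucc = p.succAbove (σ i) := by
  simp [insertLast, finSuccEquiv'_below (Fin.castSucc_lt_last i)]

theorem Equiv.Perm.insertLast_bijective (n : ℕ) :
    Function.Bijective fun x : Fin (n + 1) × Equiv.Perm (Fin n) => insertLast x.1 x.2 := by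
  rw [Fintype.bijective_iff_injective_and_card]
  refine ⟨?_, by simp [Fintype.card_perm, Nat.factorial_succ]⟩
  rintro ⟨p, σ⟩ ⟨q, τ⟩ h
  have hpq : p = q := by simpa using Equiv.congr_fun h (Fin.last n)
  subst hpq
  refine Prod.ext rfl (Equiv.ext fun i => ?_)
  simpa using Equiv.congr_fun h i.castSucc

theorem oooDist_insertLast_castSucc {n : ℕ} (p : Fin (n + 1)) (σ : Equiv.Perm (Fin n))
    (i : Fin n) : oooDist (Equiv.Perm.insertLast p σ) i.castSucc = oooDist σ i := by
  simp only [oooDist, Finset.card_filter, Fin.sum_univ_castSucc]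
  simp [Fin.succAbove_lt_succAbove_iff, (Fin.castSucc_lt_last i).not_gt]

theorem dBounded_insertLast_iff {n d : ℕ} (p : Fin (n + 1)) (σ : Equiv.Perm (Fin n)) :
    DBounded d (Equiv.Perm.insertLast p σ) ↔ n - p ≤ d ∧ DBounded d σ := by
  simp only [DBounded, Fin.forall_fin_succ', oooDist_insertLast_castSucc, oooDist_last,
    Equiv.Perm.insertLast_last, and_comm]

theorem Fin.ncard_setOf_sub_le (n d : ℕ) :
    {p : Fin (n + 1) | n - (p : ℕ) ≤ d}.ncard = min (n + 1) (d + 1) := by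
  have h : {p : Fin (n + 1) | n - (p : ℕ) ≤ d} =
      ((Finset.Ici (⟨n - d, by omega⟩ : Fin (n + 1)) : Finset _) : Set (Fin (n + 1))) := by
    ext p
    simp only [Set.mem_ofPred_eq, Finset.coe_Ici, Set.mem_Ici, Fin.le_def]
    omega
  rw [h, Set.ncard_coe_finset, Fin.card_Ici]
  simp only
  omega

theorem count_d_bounded_perms_prod (m d : ℕ) :
    Set.ncard {π : Equiv.Perm (Fin m) | DBounded d π} =
      ∏ k ∈ Finset.Icc 1 m, min k (d + 1) := by
  induction m with
  | zero => simp [DBounded]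
  | succ n ih =>
    have hb := Equiv.Perm.insertLast_bijective n
    have h : {π : Equiv.Perm (Fin (n + 1)) | DBounded d π} =
        (fun x : Fin (n + 1) × Equiv.Perm (Fin n) => Equiv.Perm.insertLast x.1 x.2) ''
          ({p : Fin (n + 1) | n - (p : ℕ) ≤ d} ×ˢ {σ | DBounded d σ}) := by
      rw [← Set.image_preimage_eq {π | DBounded d π} hb.surjective]
      congr 1
      ext x
      exact dBounded_insertLast_iff x.1 x.2
    rw [h, Set.ncard_image_of_injective _ hb.injective, Set.ncard_prod, ih,
      Fin.ncard_setOf_sub_le, Finset.prod_Icc_succ_top (by omega), mul_comm]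
end

section
/- For all natural numbers m and d, the number of d-bounded permutations of Fin (m+1) equals min(m+1, d+1) times the number of d-bounded permutations of Fin m. That is, N_d(m+1) = min(m+1, d+1) · N_d(m). -/
/-- The permutation of `Fin (m + 1)` obtained from `σ` by shifting its values up by one and
inserting the value `0` at position `p`. -/
def insertMin {m : ℕ} (p : Fin (m + 1)) (σ : Equiv.Perm (Fin m)) : Equiv.Perm (Fin (m + 1)) :=
  p.cycleRange.trans (Equiv.Perm.decomposeFin.symm (0, σ))

theorem insertMin_apply_self {m : ℕ} (p : Fin (m + 1)) (σ : Equiv.Perm (Fin m)) :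
    insertMin p σ p = 0 := by
  simp [insertMin]

theorem insertMin_apply_succAbove {m : ℕ} (p : Fin (m + 1)) (σ : Equiv.Perm (Fin m))
    (i : Fin m) : insertMin p σ (p.succAbove i) = (σ i).succ := by
  simp [insertMin]

theorem insertMin_bijective (m : ℕ) :
    Function.Bijective (fun x : Fin (m + 1) × Equiv.Perm (Fin m) => insertMin x.1 x.2) := by
  refine (Fintype.bijective_iff_injective_and_card _).2
    ⟨?_, (Fintype.card_congr Equiv.Perm.decomposeFin).symm⟩
  rintro ⟨p, σ⟩ ⟨q, τ⟩ h
  change insertMin p σ = insertMin q τ at h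
  obtain rfl : p = q := (insertMin q τ).injective <| by
    rw [insertMin_apply_self, ← h, insertMin_apply_self]
  refine Prod.ext rfl (Equiv.ext fun i => Fin.succ_injective _ ?_)
  rw [← insertMin_apply_succAbove p σ, ← insertMin_apply_succAbove p τ, h]

theorem oooDist_insertMin_self {m : ℕ} (p : Fin (m + 1)) (σ : Equiv.Perm (Fin m)) :
    oooDist (insertMin p σ) p = p := by
  have h : ∀ j, (j < p ∧ insertMin p σ p < insertMin p σ j) ↔ j < p := fun j =>
    and_iff_left_of_imp fun hj => by
      rw [insertMin_apply_self, Fin.pos_iff_ne_zero, ← insertMin_apply_self p σ]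
      exact (insertMin p σ).injective.ne hj.ne
  simp only [oooDist, h, Finset.filter_gt_eq_Iio, Fin.card_Iio]

theorem oooDist_insertMin_succAbove {m : ℕ} (p : Fin (m + 1)) (σ : Equiv.Perm (Fin m))
    (i : Fin m) : oooDist (insertMin p σ) (p.succAbove i) = oooDist σ i := by
  simp only [oooDist, Finset.card_filter]
  rw [Fin.sum_univ_succAbove _ p]
  simp [insertMin_apply_self, insertMin_apply_succAbove]

theorem dBounded_insertMin_iff {m d : ℕ} (p : Fin (m + 1)) (σ : Equiv.Perm (Fin m)) :
    DBounded d (insertMin p σ) ↔ (p : ℕ) ≤ d ∧ DBounded d σ := by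
  simp only [DBounded, Fin.forall_iff_succAbove p, oooDist_insertMin_self,
    oooDist_insertMin_succAbove]

theorem ncard_fin_val_le (n d : ℕ) : {p : Fin n | (p : ℕ) ≤ d}.ncard = min n (d + 1) := by
  simp only [← Nat.lt_succ_iff, Set.ncard_eq_toFinset_card', Set.toFinset_ofPred,
    Fin.card_filter_val_lt, Nat.succ_eq_add_one]

theorem count_d_bounded_perms_recursion (m d : ℕ) :
    Set.ncard {π : Equiv.Perm (Fin (m + 1)) | DBounded d π} =
      min (m + 1) (d + 1) * Set.ncard {π : Equiv.Perm (Fin m) | DBounded d π} := by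
  have h : {p : Fin (m + 1) | (p : ℕ) ≤ d} ×ˢ {σ : Equiv.Perm (Fin m) | DBounded d σ} =
      (fun x => insertMin x.1 x.2) ⁻¹' {π | DBounded d π} := by
    ext ⟨p, σ⟩
    exact (dBounded_insertMin_iff p σ).symm
  rw [← ncard_fin_val_le, ← Set.ncard_prod, h,
    ← Set.ncard_image_of_injective _ (insertMin_bijective m).injective,
    Set.image_preimage_eq _ (insertMin_bijective m).surjective]
end

section
/- Let α be a linear order, let l be a nonempty duplicate-free list over α that is d-bounded, and let x be the minimum element occurring in l. Then the list obtained from l by erasing x is also d-bounded. -/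
/-- The out-of-order distance of a list `l` at index `i`:
the number of indices `j < i` whose entry exceeds the entry at `i`. -/
def listOooDist {α : Type*} [LinearOrder α] (l : List α) (i : Fin l.length) : ℕ :=
  (Finset.univ.filter (fun j : Fin l.length => (j : ℕ) < (i : ℕ) ∧ l.get i < l.get j)).card

/-- A list is `d`-bounded if every index is out of order by at most `d`. -/
def ListDBounded {α : Type*} [LinearOrder α] (d : ℕ) (l : List α) : Prop :=
  ∀ i : Fin l.length, listOooDist l i ≤ d

/-- Every sublist of a `d`-bounded list is `d`-bounded. -/
theorem ListDBounded.sublist {α : Type*} [LinearOrder α] {d : ℕ} {l l' : List α}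
    (hb : ListDBounded d l) (h : l'.Sublist l) : ListDBounded d l' := by
  obtain ⟨f, hf⟩ := List.sublist_iff_exists_fin_orderEmbedding_get_eq.mp h
  intro i
  refine le_trans ?_ (hb (f i))
  refine Finset.card_le_card_of_injOn f ?_ f.injective.injOn
  intro j hj
  obtain ⟨hji, hlt⟩ : (j : ℕ) < i ∧ l'.get i < l'.get j := by simpa using hj
  have hfji : f j < f i := f.lt_iff_lt.mpr hji
  rw [hf, hf] at hlt
  simpa using And.intro hfji hlt

theorem erase_min_d_bounded {α : Type*} [LinearOrder α] (d : ℕ) (l : List α)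
    (hne : l ≠ []) (hnd : l.Nodup) (hb : ListDBounded d l)
    (x : α) (hx : x ∈ l) (hmin : ∀ y ∈ l, x ≤ y) :
    ListDBounded d (l.erase x) := by
  exact hb.sublist List.erase_sublist
end

section
/- Let α be a linear order, let l be a duplicate-free list over α that is d-bounded, let x ∈ α be strictly less than every element of l, and let k be a natural number with k ≤ d and k ≤ length of l. Then the list obtained by inserting x into l at position k is d-bounded (and duplicate-free). -/
theorem listOooDist_le_index {α : Type*} [LinearOrder α] (l : List α) (i : Fin l.length) :
    listOooDist l i ≤ i := by
  calc listOooDist l i ≤ (Finset.Iio i).card := by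
        refine Finset.card_le_card fun j hj => ?_
        simp only [Finset.mem_filter] at hj
        exact Finset.mem_Iio.2 hj.2.1
    _ = i := Fin.card_Iio i

/-- The position in `l.insertIdx k x` of the entry of `l` at a given position. -/
def insertIdxShift {α : Type*} (l : List α) (x : α) {k : ℕ} (hk : k ≤ l.length)
    (j : Fin l.length) : Fin (l.insertIdx k x).length :=
  ⟨if (j : ℕ) < k then j else j + 1, by
    rw [List.length_insertIdx_of_le_length hk]
    split <;> omega⟩

theorem get_insertIdxShift {α : Type*} (l : List α) (x : α) {k : ℕ} (hk : k ≤ l.length)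
    (j : Fin l.length) : (l.insertIdx k x).get (insertIdxShift l x hk j) = l.get j := by
  simp only [insertIdxShift, List.get_eq_getElem, List.getElem_insertIdx]
  grind

theorem exists_insertIdxShift_eq {α : Type*} (l : List α) (x : α) {k : ℕ} (hk : k ≤ l.length)
    {i : Fin (l.insertIdx k x).length} (hi : (i : ℕ) ≠ k) :
    ∃ j, insertIdxShift l x hk j = i := by
  have hlen := List.length_insertIdx_of_le_length hk x
  obtain ⟨i, h⟩ := i
  simp only at hi
  rcases lt_or_gt_of_ne hi with hik | hik
  · exact ⟨⟨i, by omega⟩, Fin.ext (by simp [insertIdxShift, hik])⟩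
  · exact ⟨⟨i - 1, by omega⟩, Fin.ext (by simp only [insertIdxShift]; split <;> omega)⟩

theorem listOooDist_insertIdxShift_le {α : Type*} [LinearOrder α] (l : List α) (x : α)
    (hlt : ∀ y ∈ l, x < y) {k : ℕ} (hk : k ≤ l.length) (i : Fin l.length) :
    listOooDist (l.insertIdx k x) (insertIdxShift l x hk i) ≤ listOooDist l i := by
  refine le_trans (Finset.card_le_card fun j hj => ?_)
    (Finset.card_image_le (f := insertIdxShift l x hk))
  simp only [Finset.mem_filter, Finset.mem_univ, true_and, get_insertIdxShift] at hj
  have hjk : (j : ℕ) ≠ k := by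
    intro h
    have hx : (l.insertIdx k x).get j = x := by
      simp [h]
    exact lt_asymm (hlt _ (l.get_mem i)) (hx ▸ hj.2)
  obtain ⟨j, rfl⟩ := exists_insertIdxShift_eq l x hk hjk
  rw [get_insertIdxShift] at hj
  refine Finset.mem_image_of_mem _ (Finset.mem_filter.2 ⟨Finset.mem_univ _, ?_, hj.2⟩)
  have hji := hj.1
  simp only [insertIdxShift] at hji
  split_ifs at hji <;> omega


theorem insert_new_min_d_bounded {α : Type*} [LinearOrder α] (d : ℕ) (l : List α)
    (hnd : l.Nodup) (hb : ListDBounded d l)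
    (x : α) (hlt : ∀ y ∈ l, x < y) (k : ℕ) (hkd : k ≤ d) (hkl : k ≤ l.length) :
    ListDBounded d (l.insertIdx k x) ∧ (l.insertIdx k x).Nodup := by
  refine ⟨fun i => ?_, ?_⟩
  · by_cases hi : (i : ℕ) = k
    · exact (listOooDist_le_index _ i).trans (hi.le.trans hkd)
    · obtain ⟨j, rfl⟩ := exists_insertIdxShift_eq l x hkl hi
      exact (listOooDist_insertIdxShift_le l x hlt hkl j).trans (hb j)
  · rw [(List.perm_insertIdx x l hkl).nodup_iff, List.nodup_cons]
    exact ⟨fun hx => lt_irrefl x (hlt x hx), hnd⟩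
end

section
/- There exists a real constant c > 0 such that for all natural numbers m ≥ 2 and all natural numbers d with 1 ≤ d ≤ m, one has Real.log (d! · (d+1)^(m−d)) ≥ c · m · Real.log (d+1). -/
theorem succ_pow_self_le_three_mul_pow_self {n : ℕ} (hn : n ≠ 0) :
    ((n : ℝ) + 1) ^ n ≤ 3 * (n : ℝ) ^ n := by
  have hn' : (n : ℝ) ≠ 0 := Nat.cast_ne_zero.mpr hn
  calc ((n : ℝ) + 1) ^ n = ((n : ℝ)⁻¹ + 1) ^ n * (n : ℝ) ^ n := by
        rw [← mul_pow, add_mul, inv_mul_cancel₀ hn', one_mul, add_comm]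
    _ ≤ Real.exp (n : ℝ)⁻¹ ^ n * (n : ℝ) ^ n := by
        gcongr
        exact Real.add_one_le_exp _
    _ = Real.exp 1 * (n : ℝ) ^ n := by
        rw [← Real.exp_nat_mul, mul_inv_cancel₀ hn']
    _ ≤ 3 * (n : ℝ) ^ n := by
        gcongr
        exact (Real.exp_one_lt_d9.trans (by norm_num)).le

theorem succ_pow_self_le_factorial_pow_four {d : ℕ} (hd : 2 ≤ d) :
    ((d : ℝ) + 1) ^ d ≤ (d.factorial : ℝ) ^ 4 := by
  induction d, hd using Nat.le_induction with
  | base => norm_num [Nat.factorial]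
  | succ d hd ih =>
    have h := succ_pow_self_le_three_mul_pow_self d.succ_ne_zero
    have hd' : (2 : ℝ) ≤ d := by exact_mod_cast hd
    push_cast [Nat.factorial_succ] at h ⊢
    calc ((d : ℝ) + 1 + 1) ^ (d + 1) ≤ 3 * ((d : ℝ) + 1) ^ (d + 1) := h
      _ ≤ ((d : ℝ) + 1) ^ 3 * ((d : ℝ) + 1) ^ (d + 1) := by
          gcongr
          nlinarith [sq_nonneg (d : ℝ)]
      _ = ((d : ℝ) + 1) ^ 4 * ((d : ℝ) + 1) ^ d := by ring
      _ ≤ ((d : ℝ) + 1) ^ 4 * (d.factorial : ℝ) ^ 4 := by gcongr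
      _ = _ := (mul_pow _ _ _).symm

theorem log_count_lower_bound :
    ∃ c : ℝ, 0 < c ∧ ∀ m d : ℕ, 2 ≤ m → 1 ≤ d → d ≤ m →
      Real.log ((d.factorial * (d + 1) ^ (m - d) : ℕ) : ℝ) ≥
        c * (m : ℝ) * Real.log ((d : ℝ) + 1) := by
  refine ⟨1 / 4, by norm_num, fun m d hm hd hdm => ?_⟩
  have hfac : (d.factorial : ℝ) ≠ 0 := Nat.cast_ne_zero.mpr d.factorial_ne_zero
  have hlog : 0 ≤ Real.log ((d : ℝ) + 1) := Real.log_nonneg (by simp)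
  have hm' : (2 : ℝ) ≤ m := by exact_mod_cast hm
  have hdm' : (d : ℝ) ≤ m := by exact_mod_cast hdm
  push_cast
  rw [Real.log_mul hfac (by positivity), Real.log_pow, Nat.cast_sub hdm]
  obtain rfl | hd2 := hd.eq_or_lt
  · simp only [Nat.factorial_one, Nat.cast_one, Real.log_one] at hlog ⊢
    generalize Real.log (1 + 1) = L at hlog ⊢
    nlinarith [mul_nonneg (sub_nonneg.mpr hm') hlog]
  · have h := Real.log_le_log (by positivity) (succ_pow_self_le_factorial_pow_four hd2)
    rw [Real.log_pow, Real.log_pow] at h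
    push_cast at h
    nlinarith [mul_nonneg (sub_nonneg.mpr hdm') hlog]
end
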